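/- arXiv:1506.08883 — 2 statements merged into one kernel-verified Lean document; each statement's English description precedes it below -/
import Mathlib

section
/- Let ψ be a non-negative tripartite pure state on systems A, B, C with ρ_AC = ρ_A ⊗ ρ_C, and suppose S(ρ_A) > 0 and S(ρ_C) > 0. Then the average post-measurement entropy is strictly smaller than the larger of the two initial entropies: Σ_j P_j · S(ρ_A(j)) < max(S(ρ_A), S(ρ_C)), where the sum runs over measurement outcomes j on B with P_j > 0. -/
open scoped BigOperators Kronecker
open scoped Classical

noncomputable def rhoA {dA dB dC : ℕ} (ψ : Fin dA × Fin dB × Fin dC → ℂ) :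
    Matrix (Fin dA) (Fin dA) ℂ :=
  Matrix.of fun i i' => ∑ j : Fin dB, ∑ k : Fin dC,
    ψ (i, j, k) * (starRingEnd ℂ) (ψ (i', j, k))

noncomputable def rhoC {dA dB dC : ℕ} (ψ : Fin dA × Fin dB × Fin dC → ℂ) :
    Matrix (Fin dC) (Fin dC) ℂ :=
  Matrix.of fun k k' => ∑ i : Fin dA, ∑ j : Fin dB,
    ψ (i, j, k) * (starRingEnd ℂ) (ψ (i, j, k'))

noncomputable def rhoAC {dA dB dC : ℕ} (ψ : Fin dA × Fin dB × Fin dC → ℂ) :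
    Matrix (Fin dA × Fin dC) (Fin dA × Fin dC) ℂ :=
  Matrix.of fun p q => ∑ j : Fin dB, ψ (p.1, j, p.2) * (starRingEnd ℂ) (ψ (q.1, j, q.2))

noncomputable def probB {dA dB dC : ℕ} (ψ : Fin dA × Fin dB × Fin dC → ℂ) (j : Fin dB) : ℝ :=
  ∑ i : Fin dA, ∑ k : Fin dC, Complex.normSq (ψ (i, j, k))

noncomputable def rhoAPost {dA dB dC : ℕ} (ψ : Fin dA × Fin dB × Fin dC → ℂ) (j : Fin dB) :
    Matrix (Fin dA) (Fin dA) ℂ :=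
  Matrix.of fun i i' => (probB ψ j : ℂ)⁻¹ *
    ∑ k : Fin dC, ψ (i, j, k) * (starRingEnd ℂ) (ψ (i', j, k))

def Normalized {dA dB dC : ℕ} (ψ : Fin dA × Fin dB × Fin dC → ℂ) : Prop :=
  ∑ i : Fin dA, ∑ j : Fin dB, ∑ k : Fin dC, Complex.normSq (ψ (i, j, k)) = 1

def NonNeg {dA dB dC : ℕ} (ψ : Fin dA × Fin dB × Fin dC → ℂ) : Prop :=
  ∀ x, 0 ≤ (ψ x).re ∧ (ψ x).im = 0

noncomputable def vnEntropy {n : Type*} [Fintype n] [DecidableEq n]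
    (ρ : Matrix n n ℂ) : ℝ :=
  if h : ρ.IsHermitian then -∑ a, h.eigenvalues a * Real.log (h.eigenvalues a) else 0

open Matrix

/-- The sum of `-x log x` over the real roots of the characteristic polynomial. -/
noncomputable def specEntropy {n : Type*} [Fintype n] [DecidableEq n] (R : Matrix n n ℝ) : ℝ :=
  (R.charpoly.roots.map Real.negMulLog).sum

theorem specEntropy_eq_sum_eigenvalues {n : Type*} [Fintype n] [DecidableEq n]
    {R : Matrix n n ℝ} (h : R.IsHermitian) :
    specEntropy R = ∑ a, Real.negMulLog (h.eigenvalues a) := by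
  rw [specEntropy, h.roots_charpoly_eq_eigenvalues, Multiset.map_map]
  rfl

theorem vnEntropy_map_ofReal {n : Type*} [Fintype n] [DecidableEq n]
    {R : Matrix n n ℝ} (h : R.IsHermitian) :
    vnEntropy (R.map Complex.ofReal) = specEntropy R := by
  have hC : (R.map Complex.ofReal).IsHermitian := by
    ext i j
    have := congrFun (congrFun h i) j
    simp only [conjTranspose_apply, star_trivial] at this
    simp [this]
  have hroots : (R.map Complex.ofReal).charpoly.roots = R.charpoly.roots.map Complex.ofReal := by
    have h1 : (R.map Complex.ofReal).charpoly = R.charpoly.map Complex.ofRealHom :=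
      charpoly_map R Complex.ofRealHom
    rw [h1]
    exact h.splits_charpoly.roots_map _
  rw [vnEntropy, dif_pos hC, specEntropy]
  have h2 : R.charpoly.roots = Multiset.map hC.eigenvalues Finset.univ.val := by
    have h3 := congrArg (Multiset.map Complex.re) hroots
    rw [hC.roots_charpoly_eq_eigenvalues, Multiset.map_map, Multiset.map_map] at h3
    simpa [Function.comp_def] using h3.symm
  rw [h2, Multiset.map_map, ← Finset.sum_neg_distrib]
  exact Finset.sum_congr rfl fun a _ => (neg_mul _ _).symm

theorem specEntropy_mul_comm {m n : Type*} [Fintype m] [DecidableEq m] [Fintype n] [DecidableEq n]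
    (A : Matrix m n ℝ) (B : Matrix n m ℝ) : specEntropy (A * B) = specEntropy (B * A) := by
  have h := congrArg (fun p => (p.roots.map Real.negMulLog).sum) (charpoly_mul_comm' A B)
  have hX : ∀ k : ℕ, (Polynomial.X ^ k : Polynomial ℝ) ≠ 0 := fun k =>
    pow_ne_zero _ Polynomial.X_ne_zero
  simpa [specEntropy, Polynomial.roots_mul, hX, (charpoly_monic _).ne_zero, Multiset.map_nsmul,
    Multiset.sum_nsmul] using h

theorem Matrix.IsHermitian.exists_dotProduct_eigenbasis {n : Type*} [Fintype n] [DecidableEq n]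
    {R : Matrix n n ℝ} (h : R.IsHermitian) :
    ∃ u : n → n → ℝ, (∀ a, R *ᵥ u a = h.eigenvalues a • u a) ∧
      (∀ x y, ∑ a, (x ⬝ᵥ u a) * (u a ⬝ᵥ y) = x ⬝ᵥ y) ∧ ∀ a, u a ⬝ᵥ u a = 1 := by
  refine ⟨fun a => (h.eigenvectorBasis a).ofLp, fun a => h.mulVec_eigenvectorBasis a, ?_, ?_⟩
  · intro x y
    have := h.eigenvectorBasis.sum_inner_mul_inner (WithLp.toLp 2 x) (WithLp.toLp 2 y)
    simp only [EuclideanSpace.inner_eq_star_dotProduct, star_trivial] at this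
    simpa only [dotProduct_comm] using this
  · intro a
    have := h.eigenvectorBasis.inner_eq_one a
    simpa only [EuclideanSpace.inner_eq_star_dotProduct, star_trivial] using this

theorem Matrix.IsHermitian.dotProduct_mulVec_comm {n : Type*} [Fintype n]
    {R : Matrix n n ℝ} (h : R.IsHermitian) (x y : n → ℝ) : x ⬝ᵥ R *ᵥ y = (R *ᵥ x) ⬝ᵥ y := by
  have h' : Rᵀ = R := by rw [← conjTranspose_eq_transpose_of_trivial]; exact h
  rw [dotProduct_mulVec, ← mulVec_transpose, h']

theorem Matrix.dotProduct_mulVec_eq_sum {m n : Type*} [Fintype m] [Fintype n]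
    (R : Matrix m n ℝ) (x : m → ℝ) (y : n → ℝ) :
    x ⬝ᵥ R *ᵥ y = ∑ i, ∑ k, x i * y k * R i k := by
  simp only [dotProduct, mulVec, Finset.mul_sum]
  exact Finset.sum_congr rfl fun i _ => Finset.sum_congr rfl fun k _ => by ring

/-- Concavity of the entropy, with its equality case. -/
theorem specEntropy_concave {n ι : Type*} [Fintype n] [DecidableEq n] [Fintype ι]
    {p : ι → ℝ} {ρ : ι → Matrix n n ℝ} {σ : Matrix n n ℝ}
    (hp0 : ∀ j, 0 ≤ p j) (hp1 : ∑ j, p j = 1) (hρ : ∀ j, (ρ j).PosSemidef)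
    (hσ : σ = ∑ j, p j • ρ j) :
    ∑ j, p j * specEntropy (ρ j) ≤ specEntropy σ ∧
      (∑ j, p j * specEntropy (ρ j) = specEntropy σ → ∀ j, 0 < p j → ρ j = σ) := by
  have hσH : σ.IsHermitian := by
    rw [hσ, IsHermitian, conjTranspose_sum]
    exact Finset.sum_congr rfl fun j _ => by rw [conjTranspose_smul, (hρ j).1, star_trivial]
  obtain ⟨u, huR, hu, hu1⟩ := hσH.exists_dotProduct_eigenbasis
  choose v hvR hv hv1 using fun j => (hρ j).1.exists_dotProduct_eigenbasis
  set μ : ι → n → ℝ := fun j => (hρ j).1.eigenvalues with hμ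
  set w : n → ι × n → ℝ := fun a q => p q.1 * (u a ⬝ᵥ v q.1 q.2) ^ 2 with hw
  have hw0 : ∀ a, ∀ q ∈ Finset.univ, 0 ≤ w a q := fun a q _ =>
    mul_nonneg (hp0 _) (sq_nonneg _)
  have hw1 : ∀ a, ∑ q, w a q = 1 := by
    intro a
    simp only [hw, Fintype.sum_prod_type, ← Finset.mul_sum]
    rw [← hp1]
    refine Finset.sum_congr rfl fun j _ => ?_
    have := hv j (u a) (u a)
    rw [hu1] at this
    simp only [dotProduct_comm _ (u a), ← sq] at this
    rw [this, mul_one]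
  have hw1' : ∀ j b, ∑ a, (u a ⬝ᵥ v j b) ^ 2 = 1 := by
    intro j b
    have := hu (v j b) (v j b)
    rw [hv1] at this
    simpa only [dotProduct_comm (v j b) (u _), ← sq] using this
  have hmean : ∀ a, ∑ q, w a q • μ q.1 q.2 = hσH.eigenvalues a := by
    intro a
    have h1 : hσH.eigenvalues a = u a ⬝ᵥ σ *ᵥ u a := by
      rw [huR, dotProduct_smul, hu1, smul_eq_mul, mul_one]
    rw [h1, hσ, sum_mulVec, dotProduct_sum, Fintype.sum_prod_type]
    refine Finset.sum_congr rfl fun j _ => ?_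
    rw [smul_mulVec, dotProduct_smul, ← hv j, smul_eq_mul, Finset.mul_sum]
    refine Finset.sum_congr rfl fun b _ => ?_
    rw [(hρ j).1.dotProduct_mulVec_comm, hvR, smul_dotProduct, dotProduct_comm (v j b)]
    simp only [hw, hμ, smul_eq_mul]
    ring
  have hmem : ∀ q ∈ (Finset.univ : Finset (ι × n)), μ q.1 q.2 ∈ Set.Ici (0 : ℝ) := fun q _ =>
    (hρ q.1).eigenvalues_nonneg q.2
  have hlhs : ∑ j, p j * specEntropy (ρ j) =
      ∑ a, ∑ q, w a q • Real.negMulLog (μ q.1 q.2) := by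
    rw [Finset.sum_comm, Fintype.sum_prod_type]
    refine Finset.sum_congr rfl fun j _ => ?_
    rw [specEntropy_eq_sum_eigenvalues (hρ j).1, Finset.mul_sum]
    refine Finset.sum_congr rfl fun b _ => ?_
    simp only [hw, smul_eq_mul, ← Finset.sum_mul, ← Finset.mul_sum, hw1', mul_one, hμ]
  have hle : ∀ a ∈ Finset.univ, ∑ q, w a q • Real.negMulLog (μ q.1 q.2) ≤
      Real.negMulLog (hσH.eigenvalues a) := by
    intro a _
    rw [← hmean]
    exact Real.concaveOn_negMulLog.le_map_sum (hw0 a) (hw1 a) hmem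
  rw [hlhs, specEntropy_eq_sum_eigenvalues hσH]
  refine ⟨Finset.sum_le_sum hle, fun heq j hj => ?_⟩
  have heq' := (Finset.sum_eq_sum_iff_of_le hle).1 heq
  have hD : ∀ a b, u a ⬝ᵥ ρ j *ᵥ v j b = u a ⬝ᵥ σ *ᵥ v j b := by
    intro a b
    rw [hvR, hσH.dotProduct_mulVec_comm, huR, dotProduct_smul, smul_dotProduct]
    by_cases h0 : u a ⬝ᵥ v j b = 0
    · simp [h0]
    · have h1 := heq' a (Finset.mem_univ a)
      rw [← hmean] at h1
      have h2 := (Real.strictConcaveOn_negMulLog.map_sum_eq_iff' (hw0 a) (hw1 a) hmem).1 h1.symm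
        (j, b) (Finset.mem_univ _) (mul_ne_zero hj.ne' (pow_ne_zero 2 h0))
      rw [hmean] at h2
      rw [← h2]
  have hvec : ∀ b, ρ j *ᵥ v j b = σ *ᵥ v j b := by
    intro b
    refine dotProduct_eq _ _ fun x => ?_
    rw [dotProduct_comm, dotProduct_comm _ x, ← hu x, ← hu x]
    simp only [hD]
  refine ext_of_mulVec_single fun i => ?_
  refine dotProduct_eq _ _ fun x => ?_
  have hσj : ∀ y, (ρ j *ᵥ x) ⬝ᵥ y = (σ *ᵥ x) ⬝ᵥ y := by
    intro y
    rw [← hv j, ← hv j _ y]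
    refine Finset.sum_congr rfl fun b _ => ?_
    rw [← (hρ j).1.dotProduct_mulVec_comm, ← hσH.dotProduct_mulVec_comm, hvec]
  rw [← (hρ j).1.dotProduct_mulVec_comm, ← hσH.dotProduct_mulVec_comm,
    dotProduct_comm, hσj, dotProduct_comm]

/-- A non-negative symmetric matrix without zero entries outside of its zero rows and columns has a
simple largest eigenvalue. -/
theorem exists_simple_top_eigenvector {n : Type*} [Fintype n] [DecidableEq n] [Nonempty n]
    {R : Matrix n n ℝ} (hR : R.IsHermitian) (hnn : ∀ i i', 0 ≤ R i i')
    (hz : ∀ i i', R i i' = 0 → (∀ k, R i k = 0) ∨ ∀ k, R i' k = 0) (htr : 0 < R.trace) :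
    ∃ a, 0 < hR.eigenvalues a ∧ ∃ v : n → ℝ, v ⬝ᵥ v = 1 ∧ R *ᵥ v = hR.eigenvalues a • v ∧
      ∀ x, R *ᵥ x = hR.eigenvalues a • x → ∃ c : ℝ, x = c • v := by
  obtain ⟨u, huR, hu, hu1⟩ := hR.exists_dotProduct_eigenbasis
  obtain ⟨a, ha⟩ := Finite.exists_max hR.eigenvalues
  set l := hR.eigenvalues a with hl
  have hlpos : 0 < l := by
    rw [hR.trace_eq_sum_eigenvalues] at htr
    obtain ⟨b, -, hb⟩ := Finset.exists_lt_of_sum_lt (s := Finset.univ) (f := fun _ : n => (0 : ℝ))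
      (g := hR.eigenvalues) (by simpa using htr)
    exact hb.trans_le (ha b)
  have hgap : ∀ x, l * (x ⬝ᵥ x) - x ⬝ᵥ R *ᵥ x =
      ∑ b, (l - hR.eigenvalues b) * (u b ⬝ᵥ x) ^ 2 := by
    intro x
    rw [← hu x (R *ᵥ x), ← hu x x, Finset.mul_sum, ← Finset.sum_sub_distrib]
    refine Finset.sum_congr rfl fun b _ => ?_
    rw [hR.dotProduct_mulVec_comm, huR, smul_dotProduct, dotProduct_comm x, smul_eq_mul]
    ring
  have hray : ∀ x, x ⬝ᵥ R *ᵥ x ≤ l * (x ⬝ᵥ x) := by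
    intro x
    rw [← sub_nonneg, hgap]
    exact Finset.sum_nonneg fun b _ => mul_nonneg (sub_nonneg.2 (ha b)) (sq_nonneg _)
  have hzero : ∀ x, R *ᵥ x = l • x → ∀ i, (∀ k, R i k = 0) → x i = 0 := by
    intro x hx i hi
    have := congrFun hx i
    simp only [mulVec, dotProduct, hi, zero_mul, Finset.sum_const_zero, Pi.smul_apply,
      smul_eq_mul] at this
    exact (mul_eq_zero.1 this.symm).resolve_left hlpos.ne'
  have hsign : ∀ x, R *ᵥ x = l • x → ∀ i k, 0 ≤ x i * x k := by
    intro x hx i k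
    by_cases h0 : R i k = 0
    · rcases hz i k h0 with h | h
      · simp [hzero x hx i h]
      · simp [hzero x hx k h]
    have h1 := hray (fun i => |x i|)
    have h2 : x ⬝ᵥ R *ᵥ x = l * (x ⬝ᵥ x) := by rw [hx, dotProduct_smul, smul_eq_mul]
    have h3 : (fun i => |x i|) ⬝ᵥ (fun i => |x i|) = x ⬝ᵥ x := by
      simp [dotProduct, abs_mul_abs_self]
    rw [h3, ← h2, dotProduct_mulVec_eq_sum, dotProduct_mulVec_eq_sum] at h1
    have hle : ∀ i k, x i * x k * R i k ≤ |x i| * |x k| * R i k := fun i k =>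
      mul_le_mul_of_nonneg_right (by rw [← abs_mul]; exact le_abs_self _) (hnn i k)
    have h4 := (Finset.sum_eq_sum_iff_of_le
      (fun i _ => Finset.sum_le_sum fun k _ => hle i k)).1 (le_antisymm
      (Finset.sum_le_sum fun i _ => Finset.sum_le_sum fun k _ => hle i k) h1) i (Finset.mem_univ i)
    have h5 := (Finset.sum_eq_sum_iff_of_le (fun k _ => hle i k)).1 h4 k (Finset.mem_univ k)
    have h6 := mul_right_cancel₀ h0 h5
    rw [h6]
    positivity
  have horth : ∀ x y : n → ℝ, R *ᵥ x = l • x → R *ᵥ y = l • y → x ⬝ᵥ y = 0 → x ≠ 0 → y = 0 := by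
    intro x y hx hy hxy hx0
    obtain ⟨i, hi⟩ := Function.ne_iff.1 hx0
    simp only [Pi.zero_apply] at hi
    have key : ∀ s : ℝ, ∀ k, 0 ≤ (x i + s * y i) * (x k + s * y k) := fun s k =>
      hsign (x + s • y) (by rw [mulVec_add, mulVec_smul, hx, hy, smul_add, smul_comm]) i k
    have hxx := hsign x hx
    have hyy := hsign y hy
    have hprod : ∀ k m, 0 ≤ (x k * y k) * (x m * y m) := fun k m => by
      have := mul_nonneg (hxx k m) (hyy k m)
      linarith
    have hdisj : ∀ k, x k * y k = 0 := by
      intro k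
      have h1 : ∑ m, (x k * y k) * (x m * y m) = 0 := by
        rw [← Finset.mul_sum]
        exact mul_eq_zero_of_right _ hxy
      have := (Finset.sum_eq_zero_iff_of_nonneg fun m _ => hprod k m).1 h1 k (Finset.mem_univ k)
      exact mul_self_eq_zero.1 this
    have hyi : y i = 0 := (mul_eq_zero.1 (hdisj i)).resolve_left hi
    funext k
    by_contra hk
    have hxk : x k = 0 := (mul_eq_zero.1 (hdisj k)).resolve_right hk
    have h1 := key 1 k
    have h2 := key (-1) k
    rw [hyi, hxk] at h1 h2
    have h3 : x i * y k = 0 := by linarith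
    exact (mul_ne_zero hi hk) h3
  refine ⟨a, hlpos, u a, hu1 a, huR a, fun x hx => ⟨u a ⬝ᵥ x, ?_⟩⟩
  have hua : u a ≠ 0 := by
    intro h
    have := hu1 a
    rw [h, zero_dotProduct] at this
    exact zero_ne_one this
  refine sub_eq_zero.1 (horth (u a) _ (huR a) ?_ ?_ hua)
  · rw [mulVec_sub, mulVec_smul, hx, huR, smul_sub, smul_comm]
  · rw [dotProduct_sub, dotProduct_smul, hu1, smul_eq_mul, mul_one, sub_self]

/-- If all the `M j` have Gram matrices proportional to the same `R` and `C`, and their average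
`M j ⊗ M j` is `R ⊗ C`, then `R` is pure as soon as everything is non-negative. -/
theorem specEntropy_eq_zero_of_gram {m n ι : Type*} [Fintype m] [DecidableEq m] [Fintype n]
    [Fintype ι] {M : ι → Matrix m n ℝ} {P : ι → ℝ} {R : Matrix m m ℝ} {C : Matrix n n ℝ}
    (hM : ∀ j i k, 0 ≤ M j i k) (hP0 : ∀ j, 0 ≤ P j) (hP1 : ∑ j, P j = 1)
    (hM0 : ∀ j, P j = 0 → M j = 0)
    (hprod : ∀ i i' k k', ∑ j, M j i k * M j i' k' = R i i' * C k k')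
    (hR : R.PosSemidef) (hRnn : ∀ i i', 0 ≤ R i i') (htr : R.trace = 1)
    (hRj : ∀ j, 0 < P j → M j * (M j)ᵀ = P j • R)
    (hCj : ∀ j, 0 < P j → (M j)ᵀ * M j = P j • C) : specEntropy R = 0 := by
  obtain ⟨r, -, hr⟩ := Finset.exists_lt_of_sum_lt (s := Finset.univ) (f := fun _ : ι => (0 : ℝ))
    (g := P) (by simp [hP1])
  have hz : ∀ i i', R i i' = 0 → (∀ k, R i k = 0) ∨ ∀ k, R i' k = 0 := by
    intro i i' h0
    have hMM : ∀ k k', M r i k * M r i' k' = 0 := by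
      intro k k'
      have h1 := hprod i i' k k'
      rw [h0, zero_mul] at h1
      exact (Finset.sum_eq_zero_iff_of_nonneg fun j _ => mul_nonneg (hM j i k) (hM j i' k')).1 h1 r
        (Finset.mem_univ r)
    have hrow : ∀ s, (∀ k, M r s k = 0) → ∀ t, R s t = 0 := by
      intro s hs t
      have h1 := congrFun (congrFun (hRj r hr) s) t
      simp only [mul_apply, hs, zero_mul, Finset.sum_const_zero, Matrix.smul_apply, smul_eq_mul] at h1
      exact (mul_eq_zero.1 h1.symm).resolve_left hr.ne'
    by_cases h : ∀ k, M r i k = 0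
    · exact Or.inl (hrow i h)
    · push Not at h
      obtain ⟨k, hk⟩ := h
      exact Or.inr (hrow i' fun k' => (mul_eq_zero.1 (hMM k k')).resolve_left hk)
  have : Nonempty m := by
    by_contra h
    rw [not_nonempty_iff] at h
    simp [trace] at htr
  obtain ⟨a, hl, v, hv1, hRv, hsimple⟩ :=
    exists_simple_top_eigenvector hR.1 hRnn hz (by rw [htr]; exact one_pos)
  set l := hR.1.eigenvalues a with hldef
  set w := (M r)ᵀ *ᵥ v with hw
  have hCw : C *ᵥ w = l • w := by
    have h1 : P r • (C *ᵥ w) = P r • (l • w) := by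
      rw [← smul_mulVec, ← hCj r hr, hw, ← mulVec_mulVec, mulVec_mulVec v, hRj r hr, smul_mulVec,
        hRv, mulVec_smul, mulVec_smul]
    exact smul_right_injective _ hr.ne' h1
  have hww : w ⬝ᵥ w = P r * l := by
    rw [hw, dotProduct_mulVec, vecMul_transpose, mulVec_mulVec, hRj r hr, smul_mulVec, hRv,
      smul_dotProduct, smul_dotProduct, hv1]
    simp
  have hterm : ∀ j, (v ⬝ᵥ M j *ᵥ w) ^ 2 = P j * (P r * l ^ 2) := by
    intro j
    rcases (hP0 j).eq_or_lt with hj | hj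
    · rw [hM0 j hj.symm, ← hj]
      simp
    have hRz : R *ᵥ (M j *ᵥ w) = l • (M j *ᵥ w) := by
      have h1 : P j • (R *ᵥ (M j *ᵥ w)) = P j • (l • (M j *ᵥ w)) := by
        rw [← smul_mulVec, ← hRj j hj, ← mulVec_mulVec, mulVec_mulVec w, hCj j hj, smul_mulVec,
          hCw, mulVec_smul, mulVec_smul]
      exact smul_right_injective _ hj.ne' h1
    obtain ⟨c, hc⟩ := hsimple _ hRz
    have hzz : (M j *ᵥ w) ⬝ᵥ (M j *ᵥ w) = P j * (P r * l ^ 2) := by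
      rw [dotProduct_mulVec, ← mulVec_transpose, mulVec_mulVec, hCj j hj, smul_mulVec, hCw,
        smul_dotProduct, smul_dotProduct, hww]
      simp only [smul_eq_mul]
      ring
    rw [← hzz, hc, dotProduct_smul, smul_dotProduct, dotProduct_smul, hv1]
    simp only [smul_eq_mul]
    ring
  have hsum : ∑ j, (v ⬝ᵥ M j *ᵥ w) ^ 2 = (v ⬝ᵥ R *ᵥ v) * (w ⬝ᵥ C *ᵥ w) := by
    have h1 : ∀ j, (v ⬝ᵥ M j *ᵥ w) ^ 2 =
        ∑ i, ∑ i', ∑ k, ∑ k', (v i * v i' * (w k * w k')) * (M j i k * M j i' k') := by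
      intro j
      rw [sq, dotProduct_mulVec_eq_sum, Finset.sum_mul_sum]
      refine Finset.sum_congr rfl fun i _ => Finset.sum_congr rfl fun i' _ => ?_
      rw [Finset.sum_mul_sum]
      exact Finset.sum_congr rfl fun k _ => Finset.sum_congr rfl fun k' _ => by ring
    have h2 : (v ⬝ᵥ R *ᵥ v) * (w ⬝ᵥ C *ᵥ w) =
        ∑ i, ∑ i', ∑ k, ∑ k', (v i * v i' * (w k * w k')) * (R i i' * C k k') := by
      rw [dotProduct_mulVec_eq_sum, dotProduct_mulVec_eq_sum]
      simp only [Finset.sum_mul]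
      refine Finset.sum_congr rfl fun i _ => Finset.sum_congr rfl fun i' _ => ?_
      simp only [Finset.mul_sum]
      exact Finset.sum_congr rfl fun k _ => Finset.sum_congr rfl fun k' _ => by ring
    rw [h2]
    simp only [h1, ← hprod, Finset.mul_sum]
    rw [Finset.sum_comm]
    refine Finset.sum_congr rfl fun i _ => ?_
    rw [Finset.sum_comm]
    refine Finset.sum_congr rfl fun i' _ => ?_
    rw [Finset.sum_comm]
    refine Finset.sum_congr rfl fun k _ => ?_
    rw [Finset.sum_comm]
  have hl1 : l = 1 := by
    simp only [hterm, ← Finset.sum_mul, hP1] at hsum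
    rw [hRv, hCw, dotProduct_smul, dotProduct_smul, hv1, hww] at hsum
    simp only [smul_eq_mul] at hsum
    have h1 : P r * l ^ 2 * (l - 1) = 0 := by linarith
    have h2 := (mul_eq_zero.1 h1).resolve_left (by positivity)
    linarith
  have htr' : ∑ b, hR.1.eigenvalues b = 1 := by
    have := hR.1.trace_eq_sum_eigenvalues
    rw [htr] at this
    exact this.symm
  have hrest : ∀ b, b ≠ a → hR.1.eigenvalues b = 0 := by
    intro b hb
    rw [← Finset.add_sum_erase _ _ (Finset.mem_univ a), ← hldef, hl1] at htr'
    have h1 : ∑ b ∈ Finset.univ.erase a, hR.1.eigenvalues b = 0 := by linarith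
    exact (Finset.sum_eq_zero_iff_of_nonneg fun b _ => hR.eigenvalues_nonneg b).1 h1 b
      (Finset.mem_erase.2 ⟨hb, Finset.mem_univ b⟩)
  rw [specEntropy_eq_sum_eigenvalues hR.1]
  refine Finset.sum_eq_zero fun b _ => ?_
  by_cases hb : b = a
  · rw [hb, ← hldef, hl1, Real.negMulLog_one]
  · rw [hrest b hb, Real.negMulLog_zero]

theorem stmt6 {dA dB dC : ℕ} (ψ : Fin dA × Fin dB × Fin dC → ℂ)
    (hnorm : Normalized ψ) (hpos : NonNeg ψ)
    (hfac : rhoAC ψ = rhoA ψ ⊗ₖ rhoC ψ)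
    (hSA : 0 < vnEntropy (rhoA ψ)) (hSC : 0 < vnEntropy (rhoC ψ)) :
    (∑ j ∈ Finset.univ.filter (fun j => 0 < probB ψ j),
        probB ψ j * vnEntropy (rhoAPost ψ j)) <
      max (vnEntropy (rhoA ψ)) (vnEntropy (rhoC ψ)) := by
  set M : Fin dB → Matrix (Fin dA) (Fin dC) ℝ := fun j => of fun i k => (ψ (i, j, k)).re with hM
  have hψ : ∀ i j k, ψ (i, j, k) = (M j i k : ℂ) := fun i j k =>
    Complex.ext (by simp [hM]) (by simp [(hpos (i, j, k)).2])
  have hMnn : ∀ j i k, 0 ≤ M j i k := fun j i k => (hpos (i, j, k)).1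
  set R := ∑ j, M j * (M j)ᵀ with hR
  set C := ∑ j, (M j)ᵀ * M j with hC
  set P := probB ψ with hPdef
  have hP : ∀ j, P j = ∑ i, ∑ k, M j i k * M j i k := by
    intro j
    simp only [hPdef, probB, hψ, Complex.normSq_ofReal]
  have hP0 : ∀ j, 0 ≤ P j := fun j => by
    rw [hP]
    exact Finset.sum_nonneg fun i _ => Finset.sum_nonneg fun k _ => mul_self_nonneg _
  have hM0 : ∀ j, P j = 0 → M j = 0 := by
    intro j hj
    rw [hP] at hj
    ext i k
    have h0 := (Finset.sum_eq_zero_iff_of_nonneg fun i _ =>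
      Finset.sum_nonneg fun k _ => mul_self_nonneg (M j i k)).1 hj i (Finset.mem_univ i)
    have h1 := (Finset.sum_eq_zero_iff_of_nonneg fun k _ => mul_self_nonneg (M j i k)).1 h0 k
      (Finset.mem_univ k)
    exact mul_self_eq_zero.1 h1
  have hP1 : ∑ j, P j = 1 := by
    rw [← hnorm, Finset.sum_comm]
    rfl
  have hRapply : ∀ i i', R i i' = ∑ j, ∑ k, M j i k * M j i' k := fun i i' => by
    simp only [hR, Matrix.sum_apply, mul_apply, transpose_apply]
  have hCapply : ∀ k k', C k k' = ∑ j, ∑ i, M j i k * M j i k' := fun k k' => by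
    simp only [hC, Matrix.sum_apply, mul_apply, transpose_apply]
  have hA : rhoA ψ = R.map Complex.ofReal := by
    ext i i'
    simp [rhoA, hψ, hRapply]
  have hCC : rhoC ψ = C.map Complex.ofReal := by
    ext k k'
    simp only [rhoC, of_apply, hψ, map_apply, hCapply]
    rw [Finset.sum_comm]
    simp
  have hpost : ∀ j, rhoAPost ψ j = ((P j)⁻¹ • (M j * (M j)ᵀ)).map Complex.ofReal := by
    intro j
    ext i i'
    simp [rhoAPost, hψ, mul_apply, hPdef]
  have hprod : ∀ i i' k k', ∑ j, M j i k * M j i' k' = R i i' * C k k' := by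
    intro i i' k k'
    have h1 := congrFun (congrFun hfac (i, k)) (i', k')
    rw [hA, hCC] at h1
    simp only [rhoAC, of_apply, hψ, kroneckerMap_apply, map_apply, Complex.conj_ofReal] at h1
    exact_mod_cast h1
  have hpsdA : ∀ j, (M j * (M j)ᵀ).PosSemidef := fun j => by
    simpa using posSemidef_self_mul_conjTranspose (M j)
  have hpsdC : ∀ j, ((M j)ᵀ * M j).PosSemidef := fun j => by
    simpa using posSemidef_conjTranspose_mul_self (M j)
  have hRpsd : R.PosSemidef := posSemidef_sum _ fun j _ => hpsdA j
  have hCpsd : C.PosSemidef := posSemidef_sum _ fun j _ => hpsdC j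
  have hRsum : R = ∑ j, P j • ((P j)⁻¹ • (M j * (M j)ᵀ)) := by
    refine Finset.sum_congr rfl fun j _ => ?_
    by_cases hj : P j = 0
    · simp [hM0 j hj]
    · rw [smul_inv_smul₀ hj]
  have hCsum : C = ∑ j, P j • ((P j)⁻¹ • ((M j)ᵀ * M j)) := by
    refine Finset.sum_congr rfl fun j _ => ?_
    by_cases hj : P j = 0
    · simp [hM0 j hj]
    · rw [smul_inv_smul₀ hj]
  have hpost' : ∀ j, ((P j)⁻¹ • (M j * (M j)ᵀ)).PosSemidef := fun j =>
    (hpsdA j).smul (inv_nonneg.2 (hP0 j))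
  have hpostC : ∀ j, ((P j)⁻¹ • ((M j)ᵀ * M j)).PosSemidef := fun j =>
    (hpsdC j).smul (inv_nonneg.2 (hP0 j))
  obtain ⟨hleA, heqA⟩ := specEntropy_concave hP0 hP1 hpost' hRsum
  obtain ⟨hleC, heqC⟩ := specEntropy_concave hP0 hP1 hpostC hCsum
  have hswap : ∀ j, specEntropy ((P j)⁻¹ • ((M j)ᵀ * M j)) =
      specEntropy ((P j)⁻¹ • (M j * (M j)ᵀ)) := fun j => by
    rw [← Matrix.smul_mul, specEntropy_mul_comm, Matrix.mul_smul]
  simp only [hswap] at hleC heqC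
  have hlhs : ∑ j ∈ Finset.univ.filter (fun j => 0 < P j), P j * vnEntropy (rhoAPost ψ j) =
      ∑ j, P j * specEntropy ((P j)⁻¹ • (M j * (M j)ᵀ)) := by
    rw [Finset.sum_filter]
    refine Finset.sum_congr rfl fun j _ => ?_
    rw [hpost, vnEntropy_map_ofReal (hpost' j).1]
    split_ifs with hj
    · rfl
    · rw [le_antisymm (not_lt.1 hj) (hP0 j), zero_mul]
  rw [hA, vnEntropy_map_ofReal hRpsd.1] at hSA ⊢
  rw [hCC, vnEntropy_map_ofReal hCpsd.1, hlhs]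
  by_contra hcon
  rw [not_lt, max_le_iff] at hcon
  have hA' := heqA (le_antisymm hleA hcon.1)
  have hC' := heqC (le_antisymm hleC hcon.2)
  refine hSA.ne' (specEntropy_eq_zero_of_gram hMnn hP0 hP1 hM0 hprod hRpsd ?_ ?_ ?_ ?_)
  · intro i i'
    rw [hRapply]
    exact Finset.sum_nonneg fun j _ => Finset.sum_nonneg fun k _ =>
      mul_nonneg (hMnn _ _ _) (hMnn _ _ _)
  · rw [trace, ← hP1]
    simp only [diag_apply, hRapply, hP]
    exact Finset.sum_comm
  · intro j hj
    rw [← hA' j hj, smul_inv_smul₀ hj.ne']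
  · intro j hj
    rw [← hC' j hj, smul_inv_smul₀ hj.ne']
end

section
/- For all dimensions d_A and d_C there exist ε > 0 and c < 1 such that the following holds for every d_B and every tripartite pure state ψ on systems A, B, C with local dimensions d_A, d_B, d_C: if ρ_AC = ρ_A ⊗ ρ_C and the second largest eigenvalue of ρ_A and the second largest eigenvalue of ρ_C are each at most ε, then Σ_j P_j · S(ρ_A(j)) ≤ c · max(S(ρ_A), S(ρ_C)), where the sum runs over measurement outcomes j on B with P_j > 0. -/
open scoped BigOperators Kronecker
open scoped Classical

/-- The second largest eigenvalue of a Hermitian matrix is at most `ε` iff all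
eigenvalues except possibly one are at most `ε`. -/
def SecondEigLE {n : Type*} [Fintype n] [DecidableEq n] {ρ : Matrix n n ℂ}
    (h : ρ.IsHermitian) (ε : ℝ) : Prop :=
  ∃ a, ∀ b, b ≠ a → h.eigenvalues b ≤ ε

open scoped Matrix ComplexOrder

theorem neg_mul_log_le_two_mul_sqrt {x : ℝ} (hx0 : 0 ≤ x) (hx1 : x ≤ 1) :
    -(x * Real.log x) ≤ 2 * √(x * (1 - x)) := by
  rcases hx0.eq_or_lt with rfl | hx
  · simp
  obtain ⟨s, hs, rfl⟩ : ∃ s : ℝ, 0 < s ∧ x = s ^ 2 :=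
    ⟨√x, Real.sqrt_pos.2 hx, (Real.sq_sqrt hx0).symm⟩
  have hs1 : s ≤ 1 := by nlinarith
  have hlog : -Real.log s ≤ s⁻¹ - 1 := by
    simpa [Real.log_inv] using Real.log_le_sub_one_of_pos (inv_pos.2 hs)
  have hsqrt : s * (1 - s) ≤ √(s ^ 2 * (1 - s ^ 2)) := by
    apply Real.le_sqrt_of_sq_le
    have h : (1 - s) ^ 2 ≤ 1 - s ^ 2 := by nlinarith
    nlinarith [mul_le_mul_of_nonneg_left h (sq_nonneg s)]
  calc -(s ^ 2 * Real.log (s ^ 2)) = 2 * s ^ 2 * -Real.log s := by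
        rw [Real.log_pow]; push_cast; ring
    _ ≤ 2 * s ^ 2 * (s⁻¹ - 1) := by gcongr
    _ = 2 * (s * (1 - s)) := by field_simp
    _ ≤ _ := by gcongr

namespace Matrix

/-- The product `‖M x‖ ‖M y‖` over pairs of entries in different rows and columns. -/
noncomputable def offCross {m n : Type*} (M : Matrix m n ℂ) (z : (m × n) × (m × n)) : ℝ :=
  if z.1.1 ≠ z.2.1 ∧ z.1.2 ≠ z.2.2 then ‖M z.1.1 z.1.2‖ * ‖M z.2.1 z.2.2‖ else 0

theorem offCross_nonneg {m n : Type*} (M : Matrix m n ℂ) (z) : 0 ≤ M.offCross z := by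
  unfold offCross; split_ifs <;> positivity

variable {m n : Type*} [Fintype m] [Fintype n]

theorem IsHermitian.trace_mul_self_eq_sum_eigenvalues [DecidableEq n] {A : Matrix n n ℂ}
    (hA : A.IsHermitian) : (A * A).trace = ∑ i, (hA.eigenvalues i : ℂ) ^ 2 := by
  conv_lhs => rw [hA.spectral_theorem, ← map_mul, Unitary.conjStarAlgAut_apply, trace_mul_comm,
    ← mul_assoc]
  simp [trace_diagonal, pow_two]

theorem IsHermitian.sum_eigenvalues_eq_one [DecidableEq n] {A : Matrix n n ℂ}
    (hA : A.IsHermitian) (htr : A.trace = 1) : ∑ i, hA.eigenvalues i = 1 := by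
  have h := hA.trace_eq_sum_eigenvalues
  rw [htr] at h
  apply Complex.ofReal_injective
  simpa using h.symm

theorem PosSemidef.eigenvalues_le_one [DecidableEq n] {A : Matrix n n ℂ}
    (hA : A.PosSemidef) (htr : A.trace = 1) (i : n) : hA.1.eigenvalues i ≤ 1 := by
  rw [← hA.1.sum_eigenvalues_eq_one htr]
  exact Finset.single_le_sum (fun j _ => hA.eigenvalues_nonneg j) (Finset.mem_univ i)

theorem IsHermitian.conjTranspose_mul_mul_eigenvectorUnitary [DecidableEq n] {A : Matrix n n ℂ}
    (hA : A.IsHermitian) :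
    (hA.eigenvectorUnitary : Matrix n n ℂ)ᴴ * A * (hA.eigenvectorUnitary : Matrix n n ℂ) =
      diagonal fun i => (hA.eigenvalues i : ℂ) := by
  have h := hA.conjStarAlgAut_star_eigenvectorUnitary
  rw [Unitary.conjStarAlgAut_star_apply] at h
  exact h

theorem trace_mul_conjTranspose_self_re (M : Matrix m n ℂ) :
    (M * Mᴴ).trace.re = ∑ x : m × n, Complex.normSq (M x.1 x.2) := by
  simp [trace, mul_apply, Fintype.sum_prod_type, Complex.mul_conj]

theorem trace_mul_conjTranspose_self_sq_re (M : Matrix m n ℂ) :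
    (M * Mᴴ * (M * Mᴴ)).trace.re = ∑ z : (m × n) × (m × n),
      (M z.1.1 z.1.2 * star (M z.2.1 z.1.2) * (M z.2.1 z.2.2 * star (M z.1.1 z.2.2))).re := by
  have h : (M * Mᴴ * (M * Mᴴ)).trace = ∑ z : (m × n) × (m × n),
      M z.1.1 z.1.2 * star (M z.2.1 z.1.2) * (M z.2.1 z.2.2 * star (M z.1.1 z.2.2)) := by
    simp only [trace, mul_apply, Fintype.sum_prod_type, diag_apply, conjTranspose_apply,
      Finset.sum_mul_sum]
    exact Finset.sum_congr rfl fun i _ => Finset.sum_comm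
  rw [h, Complex.re_sum]

theorem sq_trace_sub_trace_sq_le (M : Matrix m n ℂ) :
    (M * Mᴴ).trace.re ^ 2 - (M * Mᴴ * (M * Mᴴ)).trace.re ≤ 2 * (∑ z, M.offCross z) ^ 2 := by
  set G := ∑ z, M.offCross z
  have hG (z) : M.offCross z ≤ G :=
    Finset.single_le_sum (fun z _ => M.offCross_nonneg z) (Finset.mem_univ z)
  rw [trace_mul_conjTranspose_self_re, trace_mul_conjTranspose_self_sq_re, pow_two,
    Finset.sum_mul_sum, ← Finset.sum_product', Finset.univ_product_univ, ← Finset.sum_sub_distrib]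
  calc _ ≤ ∑ z, M.offCross z * (2 * G) := ?_
    _ = 2 * G ^ 2 := by rw [← Finset.sum_mul]; ring
  refine Finset.sum_le_sum fun z _ => ?_
  obtain ⟨⟨i, k⟩, ⟨i', k'⟩⟩ := z
  by_cases hi : i = i'
  · subst hi
    have : M.offCross ((i, k), (i, k')) = 0 := by simp [offCross]
    rw [this]
    simp [Complex.mul_conj, ← Complex.ofReal_mul]
  by_cases hk : k = k'
  · subst hk
    have : M.offCross ((i, k), (i', k)) = 0 := by simp [offCross]
    rw [this]
    refine le_of_eq ?_
    rw [show M i k * star (M i' k) * (M i' k * star (M i k)) =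
      (M i k * star (M i k)) * (M i' k * star (M i' k)) by ring]
    simp [Complex.mul_conj, ← Complex.ofReal_mul]
  have h1 : M.offCross ((i, k), (i', k')) = ‖M i k‖ * ‖M i' k'‖ := by simp [offCross, hi, hk]
  have h2 : M.offCross ((i, k'), (i', k)) = ‖M i k'‖ * ‖M i' k‖ := by
    simp [offCross, hi, Ne.symm hk]
  have h3 : -(M i k * star (M i' k) * (M i' k' * star (M i k'))).re ≤
      (‖M i k‖ * ‖M i' k'‖) * (‖M i k'‖ * ‖M i' k‖) := by
    refine (neg_le_abs _).trans ((Complex.abs_re_le_norm _).trans (le_of_eq ?_))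
    simp only [norm_mul, norm_star]; ring
  have hn := M.offCross_nonneg ((i, k), (i', k'))
  have h4 := mul_le_mul_of_nonneg_left (hG ((i, k), (i', k'))) hn
  have h5 := mul_le_mul_of_nonneg_left (hG ((i, k'), (i', k))) hn
  simp only [Complex.normSq_eq_norm_sq]
  rw [h1] at h4 h5 ⊢
  rw [h2] at h5
  nlinarith

end Matrix

theorem vnEntropy_le_sqrt {n : Type*} [Fintype n] [DecidableEq n] {ρ : Matrix n n ℂ}
    (hρ : ρ.PosSemidef) (htr : ρ.trace = 1) :
    vnEntropy ρ ≤ 2 * Fintype.card n * √(1 - (ρ * ρ).trace.re) := by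
  set l := hρ.1.eigenvalues
  have h0 (i) : 0 ≤ l i := hρ.eigenvalues_nonneg i
  have h1 (i) : l i ≤ 1 := hρ.eigenvalues_le_one htr i
  have hpur : 1 - (ρ * ρ).trace.re = ∑ i, l i * (1 - l i) := by
    have hsum : ∑ i, l i = 1 := hρ.1.sum_eigenvalues_eq_one htr
    simp only [mul_sub, mul_one, Finset.sum_sub_distrib, hsum, ← pow_two]
    rw [pow_two ρ, hρ.1.trace_mul_self_eq_sum_eigenvalues]
    norm_cast
  rw [vnEntropy, dif_pos hρ.1, hpur, ← Finset.sum_neg_distrib]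
  calc _ ≤ ∑ _i : n, 2 * √(∑ i, l i * (1 - l i)) := ?_
    _ = _ := by simp; ring
  refine Finset.sum_le_sum fun i _ => (neg_mul_log_le_two_mul_sqrt (h0 i) (h1 i)).trans ?_
  gcongr
  exact Finset.single_le_sum (f := fun i => l i * (1 - l i))
    (fun j _ => mul_nonneg (h0 j) (sub_nonneg.2 (h1 j))) (Finset.mem_univ i)

theorem mul_sum_eigenvalues_le_vnEntropy {n : Type*} [Fintype n] [DecidableEq n]
    {ρ : Matrix n n ℂ} (hρ : ρ.PosSemidef) (htr : ρ.trace = 1) {K : ℝ} {a : n}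
    (ha : ∀ b, b ≠ a → hρ.1.eigenvalues b ≤ Real.exp (-K)) :
    K * ∑ b ∈ Finset.univ.erase a, hρ.1.eigenvalues b ≤ vnEntropy ρ := by
  rw [vnEntropy, dif_pos hρ.1, ← Finset.sum_neg_distrib,
    ← Finset.add_sum_erase _ _ (Finset.mem_univ a), Finset.mul_sum]
  have h0 := hρ.eigenvalues_nonneg
  have hlast : 0 ≤ -(hρ.1.eigenvalues a * Real.log (hρ.1.eigenvalues a)) := by
    rw [neg_nonneg]
    exact mul_nonpos_of_nonneg_of_nonpos (h0 a)
      (Real.log_nonpos (h0 a) (hρ.eigenvalues_le_one htr a))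
  refine le_add_of_nonneg_of_le hlast (Finset.sum_le_sum fun b hb => ?_)
  rcases (h0 b).eq_or_lt with hb0 | hb0
  · simp [← hb0]
  · have := (Real.log_le_iff_le_exp hb0).2 (ha b (Finset.ne_of_mem_erase hb))
    nlinarith

/-- Two distinct eigenvalues have product at most the sum of all but the `a`-th eigenvalue. -/
theorem eigenvalues_mul_eigenvalues_le {n : Type*} [Fintype n] [DecidableEq n]
    {ρ : Matrix n n ℂ} (hρ : ρ.PosSemidef) (htr : ρ.trace = 1) (a : n) {i j : n} (hij : i ≠ j) :
    hρ.1.eigenvalues i * hρ.1.eigenvalues j ≤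
      ∑ b ∈ Finset.univ.erase a, hρ.1.eigenvalues b := by
  have h0 := hρ.eigenvalues_nonneg
  have h1 := hρ.eigenvalues_le_one htr
  have hle {b : n} (hb : b ≠ a) :
      hρ.1.eigenvalues b ≤ ∑ b ∈ Finset.univ.erase a, hρ.1.eigenvalues b :=
    Finset.single_le_sum (fun j _ => h0 j) (Finset.mem_erase.2 ⟨hb, Finset.mem_univ b⟩)
  by_cases hi : i = a
  · exact (mul_le_of_le_one_left (h0 j) (h1 i)).trans (hle (hi ▸ hij.symm))
  · exact (mul_le_of_le_one_right (h0 i) (h1 j)).trans (hle hi)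

theorem Matrix.conj_mul_mul_conjTranspose {m n R : Type*} [Fintype m] [Fintype n] [DecidableEq n]
    [CommRing R] [StarRing R] (M : Matrix m n R) (U : Matrix m m R) {V : Matrix n n R}
    (hV : V * Vᴴ = 1) : (Uᴴ * M * V) * (Uᴴ * M * V)ᴴ = Uᴴ * (M * Mᴴ) * U := by
  simp only [Matrix.conjTranspose_mul, Matrix.conjTranspose_conjTranspose]
  calc Uᴴ * M * V * (Vᴴ * (Mᴴ * U)) = Uᴴ * M * (V * Vᴴ) * (Mᴴ * U) := by
        simp only [Matrix.mul_assoc]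
    _ = _ := by rw [hV, Matrix.mul_one]; simp only [Matrix.mul_assoc]

/-- Purity bounds from `Matrix.sq_trace_sub_trace_sq_le` may be taken in any pair of bases. -/
theorem Matrix.sq_trace_sub_trace_sq_le_conj {m n : Type*} [Fintype m] [Fintype n]
    [DecidableEq m] [DecidableEq n] (M : Matrix m n ℂ) {U : Matrix m m ℂ} {V : Matrix n n ℂ}
    (hU : U * Uᴴ = 1) (hV : V * Vᴴ = 1) :
    (M * Mᴴ).trace.re ^ 2 - (M * Mᴴ * (M * Mᴴ)).trace.re ≤
      2 * (∑ z, (Uᴴ * M * V).offCross z) ^ 2 := by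
  have h := (Uᴴ * M * V).sq_trace_sub_trace_sq_le
  have h1 : (Uᴴ * (M * Mᴴ) * U).trace = (M * Mᴴ).trace := by
    rw [Matrix.trace_mul_comm, ← Matrix.mul_assoc, hU, Matrix.one_mul]
  have h2 : Uᴴ * (M * Mᴴ) * U * (Uᴴ * (M * Mᴴ) * U) = Uᴴ * (M * Mᴴ * (M * Mᴴ)) * U := by
    calc _ = Uᴴ * (M * Mᴴ) * (U * Uᴴ) * (M * Mᴴ) * U := by simp only [Matrix.mul_assoc]
      _ = _ := by rw [hU]; simp only [Matrix.mul_one, Matrix.mul_assoc]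
  have h3 : (Uᴴ * (M * Mᴴ * (M * Mᴴ)) * U).trace = (M * Mᴴ * (M * Mᴴ)).trace := by
    rw [Matrix.trace_mul_comm, ← Matrix.mul_assoc, hU, Matrix.one_mul]
  rwa [Matrix.conj_mul_mul_conjTranspose M U hV, h2, h1, h3] at h

section TripartiteState

variable {dA dB dC : ℕ} (ψ : Fin dA × Fin dB × Fin dC → ℂ)

/-- The unnormalized post-measurement state on `AC`, as a matrix. -/
def sliceB (j : Fin dB) : Matrix (Fin dA) (Fin dC) ℂ :=
  Matrix.of fun i k => ψ (i, j, k)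

theorem probB_eq_trace (j : Fin dB) :
    probB ψ j = (sliceB ψ j * (sliceB ψ j)ᴴ).trace.re := by
  simp [Matrix.trace_mul_conjTranspose_self_re, probB, sliceB, Fintype.sum_prod_type]

theorem trace_sliceB (j : Fin dB) :
    (sliceB ψ j * (sliceB ψ j)ᴴ).trace = (probB ψ j : ℂ) := by
  simp [probB, sliceB, Matrix.trace, Matrix.mul_apply, Complex.mul_conj]

theorem rhoAPost_eq_smul (j : Fin dB) :
    rhoAPost ψ j = ((probB ψ j)⁻¹ : ℝ) • (sliceB ψ j * (sliceB ψ j)ᴴ) := by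
  ext i i'
  simp [rhoAPost, sliceB, Matrix.mul_apply]

theorem rhoA_eq_sum : rhoA ψ = ∑ j, sliceB ψ j * (sliceB ψ j)ᴴ := by
  ext i i'
  simp [rhoA, sliceB, Matrix.mul_apply, Matrix.sum_apply]

theorem rhoC_eq_sum : rhoC ψ = ∑ j, (sliceB ψ j)ᵀ * ((sliceB ψ j)ᵀ)ᴴ := by
  ext k k'
  simp only [rhoC, sliceB, Matrix.mul_apply, Matrix.sum_apply, Matrix.of_apply,
    Matrix.transpose_apply, Matrix.conjTranspose_apply]
  exact Finset.sum_comm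

theorem posSemidef_rhoA : (rhoA ψ).PosSemidef := by
  rw [rhoA_eq_sum]
  exact Matrix.posSemidef_sum _ fun j _ => Matrix.posSemidef_self_mul_conjTranspose _

theorem posSemidef_rhoC : (rhoC ψ).PosSemidef := by
  rw [rhoC_eq_sum]
  exact Matrix.posSemidef_sum _ fun j _ => Matrix.posSemidef_self_mul_conjTranspose _

variable {ψ}

theorem Normalized.trace_rhoA (hψ : Normalized ψ) : (rhoA ψ).trace = 1 := by
  have h : (rhoA ψ).trace =
      ((∑ i, ∑ j, ∑ k, Complex.normSq (ψ (i, j, k)) : ℝ) : ℂ) := by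
    simp [rhoA, Matrix.trace, Complex.mul_conj]
  rw [h, show (∑ i, ∑ j, ∑ k, Complex.normSq (ψ (i, j, k))) = 1 from hψ, Complex.ofReal_one]

theorem Normalized.trace_rhoC (hψ : Normalized ψ) : (rhoC ψ).trace = 1 := by
  rw [← hψ.trace_rhoA, rhoC_eq_sum, rhoA_eq_sum, Matrix.trace_sum, Matrix.trace_sum]
  refine Finset.sum_congr rfl fun j _ => ?_
  simp only [Matrix.trace, Matrix.mul_apply, Matrix.diag_apply, Matrix.transpose_apply,
    Matrix.conjTranspose_apply]
  exact Finset.sum_comm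

theorem probB_mul_vnEntropy_le {j : Fin dB} (hj : 0 < probB ψ j)
    {U : Matrix (Fin dA) (Fin dA) ℂ} {V : Matrix (Fin dC) (Fin dC) ℂ}
    (hU : U * Uᴴ = 1) (hV : V * Vᴴ = 1) :
    probB ψ j * vnEntropy (rhoAPost ψ j) ≤ 4 * dA * ∑ z, (Uᴴ * sliceB ψ j * V).offCross z := by
  set P := probB ψ j with hP
  set M := sliceB ψ j
  set G := ∑ z, (Uᴴ * M * V).offCross z
  have hG : 0 ≤ G := Finset.sum_nonneg fun z _ => Matrix.offCross_nonneg _ z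
  have hpsd : (rhoAPost ψ j).PosSemidef := by
    rw [rhoAPost_eq_smul]
    exact (Matrix.posSemidef_self_mul_conjTranspose _).smul (inv_nonneg.2 hj.le)
  have htr : (rhoAPost ψ j).trace = 1 := by
    rw [rhoAPost_eq_smul, Matrix.trace_smul, trace_sliceB, Complex.real_smul,
      ← Complex.ofReal_mul, inv_mul_cancel₀ hj.ne', Complex.ofReal_one]
  have hpur : (rhoAPost ψ j * rhoAPost ψ j).trace.re = P⁻¹ ^ 2 * (M * Mᴴ * (M * Mᴴ)).trace.re := by
    rw [rhoAPost_eq_smul, Matrix.smul_mul, Matrix.mul_smul, Matrix.trace_smul, Matrix.trace_smul,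
      Complex.smul_re, Complex.smul_re, smul_eq_mul, smul_eq_mul]
    ring
  have hle := Matrix.sq_trace_sub_trace_sq_le_conj M hU hV
  rw [← probB_eq_trace, ← hP] at hle
  have hsqrt : P * √(1 - (rhoAPost ψ j * rhoAPost ψ j).trace.re) ≤ 2 * G := by
    rw [hpur, ← le_div_iff₀' hj]
    refine Real.sqrt_le_iff.2 ⟨by positivity, ?_⟩
    rw [div_pow, le_div_iff₀ (by positivity)]
    have : (1 - P⁻¹ ^ 2 * (M * Mᴴ * (M * Mᴴ)).trace.re) * P ^ 2 =
        P ^ 2 - (M * Mᴴ * (M * Mᴴ)).trace.re := by field_simp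
    rw [this]
    nlinarith [sq_nonneg G]
  have hent := vnEntropy_le_sqrt hpsd htr
  rw [Fintype.card_fin] at hent
  calc _ ≤ P * (2 * dA * √(1 - (rhoAPost ψ j * rhoAPost ψ j).trace.re)) := by gcongr
    _ = 2 * dA * (P * √(1 - (rhoAPost ψ j * rhoAPost ψ j).trace.re)) := by ring
    _ ≤ 2 * dA * (2 * G) := by gcongr
    _ = _ := by ring

theorem sum_normSq_conj_sliceB (U : Matrix (Fin dA) (Fin dA) ℂ) (V : Matrix (Fin dC) (Fin dC) ℂ)
    (i : Fin dA) (k : Fin dC) :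
    ((∑ j, ‖(Uᴴ * sliceB ψ j * (Vᴴ)ᵀ) i k‖ ^ 2 : ℝ) : ℂ) =
      ((U ⊗ₖ V)ᴴ * rhoAC ψ * (U ⊗ₖ V)) (i, k) (i, k) := by
  have hentry (j : Fin dB) : (Uᴴ * sliceB ψ j * (Vᴴ)ᵀ) i k =
      ∑ x : Fin dA × Fin dC, star ((U ⊗ₖ V) x (i, k)) * ψ (x.1, j, x.2) := by
    simp only [Matrix.mul_apply, Fintype.sum_prod_type, Finset.sum_mul, sliceB, Matrix.of_apply,
      Matrix.conjTranspose_apply, Matrix.transpose_apply, Matrix.kroneckerMap_apply, star_mul']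
    rw [Finset.sum_comm]
    exact Finset.sum_congr rfl fun a _ => Finset.sum_congr rfl fun c _ => by ring
  push_cast
  simp only [← Complex.mul_conj', hentry]
  simp only [map_sum, Matrix.mul_apply, rhoAC, Matrix.of_apply,
    Finset.mul_sum, Finset.sum_mul, Matrix.conjTranspose_apply]
  rw [Finset.sum_comm]
  refine Finset.sum_congr rfl fun x _ => ?_
  rw [Finset.sum_comm]
  refine Finset.sum_congr rfl fun y _ => Finset.sum_congr rfl fun j _ => ?_
  simp only [map_mul, starRingEnd_apply, star_star]
  ring

theorem sum_normSq_eigenbasis (hprod : rhoAC ψ = rhoA ψ ⊗ₖ rhoC ψ)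
    (hA : (rhoA ψ).IsHermitian) (hC : (rhoC ψ).IsHermitian) (i : Fin dA) (k : Fin dC) :
    ∑ j, ‖((hA.eigenvectorUnitary : Matrix (Fin dA) (Fin dA) ℂ)ᴴ * sliceB ψ j *
      ((hC.eigenvectorUnitary : Matrix (Fin dC) (Fin dC) ℂ)ᴴ)ᵀ) i k‖ ^ 2 =
      hA.eigenvalues i * hC.eigenvalues k := by
  apply Complex.ofReal_injective
  rw [sum_normSq_conj_sliceB, hprod, Matrix.conjTranspose_kronecker, ← Matrix.mul_kronecker_mul,
    ← Matrix.mul_kronecker_mul, hA.conjTranspose_mul_mul_eigenvectorUnitary,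
    hC.conjTranspose_mul_mul_eigenvectorUnitary]
  simp

end TripartiteState

theorem stmt9 (dA dC : ℕ) :
    ∃ ε : ℝ, 0 < ε ∧ ∃ c : ℝ, c < 1 ∧
      ∀ (dB : ℕ) (ψ : Fin dA × Fin dB × Fin dC → ℂ), Normalized ψ →
        rhoAC ψ = rhoA ψ ⊗ₖ rhoC ψ →
        ∀ (hA : (rhoA ψ).IsHermitian) (hC : (rhoC ψ).IsHermitian),
          SecondEigLE hA ε → SecondEigLE hC ε →
          (∑ j ∈ Finset.univ.filter (fun j => 0 < probB ψ j),
              probB ψ j * vnEntropy (rhoAPost ψ j)) ≤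
            c * max (vnEntropy (rhoA ψ)) (vnEntropy (rhoC ψ)) := by
  set K : ℝ := 4 * dA * (dA * dC * (dA * dC)) with hK
  have hK0 : 0 ≤ K := by positivity
  refine ⟨Real.exp (-(2 * K)), Real.exp_pos _, 1 / 2, by norm_num, ?_⟩
  rintro dB ψ hψ hprod hA hC ⟨a, ha⟩ ⟨b, hb⟩
  have hApsd := posSemidef_rhoA ψ
  have hCpsd := posSemidef_rhoC ψ
  set p := hA.eigenvalues
  set q := hC.eigenvalues
  set U := (hA.eigenvectorUnitary : Matrix (Fin dA) (Fin dA) ℂ)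
  set V := (hC.eigenvectorUnitary : Matrix (Fin dC) (Fin dC) ℂ)
  have hU : U * Uᴴ = 1 := Unitary.coe_mul_star_self hA.eigenvectorUnitary
  have hV : (Vᴴ)ᵀ * ((Vᴴ)ᵀ)ᴴ = 1 := by
    have h : V * Vᴴ = 1 := Unitary.coe_mul_star_self hC.eigenvectorUnitary
    rw [show ((Vᴴ)ᵀ)ᴴ = Vᵀ by ext; simp, ← Matrix.transpose_mul, h, Matrix.transpose_one]
  set N : Fin dB → Matrix (Fin dA) (Fin dC) ℂ := fun j => Uᴴ * sliceB ψ j * (Vᴴ)ᵀ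
  set α := ∑ i ∈ Finset.univ.erase a, p i
  set γ := ∑ k ∈ Finset.univ.erase b, q k
  have hα0 : 0 ≤ α := Finset.sum_nonneg fun i _ => hApsd.eigenvalues_nonneg i
  have hγ0 : 0 ≤ γ := Finset.sum_nonneg fun i _ => hCpsd.eigenvalues_nonneg i
  have hcross (z) : ∑ j, (N j).offCross z ≤ max α γ := by
    unfold Matrix.offCross
    split_ifs with hz
    · have hp := eigenvalues_mul_eigenvalues_le hApsd hψ.trace_rhoA a hz.1
      have hq := eigenvalues_mul_eigenvalues_le hCpsd hψ.trace_rhoC b hz.2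
      refine (Real.sum_mul_le_sqrt_mul_sqrt _ _ _).trans ?_
      rw [sum_normSq_eigenbasis hprod hA hC, sum_normSq_eigenbasis hprod hA hC,
        ← Real.sqrt_mul (mul_nonneg (hApsd.eigenvalues_nonneg _) (hCpsd.eigenvalues_nonneg _))]
      refine Real.sqrt_le_iff.2 ⟨le_max_of_le_left hα0, ?_⟩
      calc p z.1.1 * q z.1.2 * (p z.2.1 * q z.2.2)
          = (p z.1.1 * p z.2.1) * (q z.1.2 * q z.2.2) := by ring
        _ ≤ α * γ := mul_le_mul hp hq (mul_nonneg (hCpsd.eigenvalues_nonneg _)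
            (hCpsd.eigenvalues_nonneg _)) hα0
        _ ≤ max α γ * max α γ := by gcongr <;> simp
        _ = max α γ ^ 2 := by ring
    · simpa using Or.inl hα0
  have hSA := mul_sum_eigenvalues_le_vnEntropy hApsd hψ.trace_rhoA ha
  have hSC := mul_sum_eigenvalues_le_vnEntropy hCpsd hψ.trace_rhoC hb
  calc ∑ j ∈ Finset.univ.filter (fun j => 0 < probB ψ j), probB ψ j * vnEntropy (rhoAPost ψ j)
      ≤ ∑ j ∈ Finset.univ.filter (fun j => 0 < probB ψ j), 4 * dA * ∑ z, (N j).offCross z :=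
        Finset.sum_le_sum fun j hj => probB_mul_vnEntropy_le (Finset.mem_filter.1 hj).2 hU hV
    _ ≤ ∑ j, 4 * dA * ∑ z, (N j).offCross z :=
        Finset.sum_le_sum_of_subset_of_nonneg (Finset.filter_subset _ _) fun j _ _ =>
          mul_nonneg (by positivity) (Finset.sum_nonneg fun z _ => (N j).offCross_nonneg z)
    _ = 4 * dA * ∑ z, ∑ j, (N j).offCross z := by rw [← Finset.mul_sum, Finset.sum_comm]
    _ ≤ 4 * dA * ∑ _z : (Fin dA × Fin dC) × (Fin dA × Fin dC), max α γ := by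
        gcongr with z
        exact hcross z
    _ = 1 / 2 * (2 * K * max α γ) := by
        simp only [Finset.sum_const, Finset.card_univ, Fintype.card_prod, Fintype.card_fin, hK,
          nsmul_eq_mul]
        push_cast
        ring
    _ = 1 / 2 * max (2 * K * α) (2 * K * γ) := by rw [mul_max_of_nonneg _ _ (by positivity)]
    _ ≤ _ := by gcongr
end
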